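/- arXiv:0712.0790 — 2 statements merged into one kernel-verified Lean document; each statement's English description precedes it below -/
import Mathlib

section
/- Lower bound in the high-temperature cut-off: if 0 ≤ β < 1, then lim_{γ→∞} liminf_{n→∞} d_n( n·log n / (2(1−β)) − γn ) = 1. -/
open Filter Real

namespace CW

/-- Configurations of the Curie-Weiss model on `n` vertices:
`true` encodes spin `+1` and `false` encodes spin `-1`. -/
abbrev Config (n : ℕ) := Fin n → Bool

noncomputable section

/-- The spin (±1) at site `i`. -/
def spin {n : ℕ} (σ : Config n) (i : Fin n) : ℝ := if σ i then 1 else -1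

/-- Normalized magnetization `S(σ) = n⁻¹ ∑ᵢ σ(i)`. -/
def mag {n : ℕ} (σ : Config n) : ℝ := (∑ i, spin σ i) / n

/-- `p₊(s) = (1 + tanh(βs))/2`. -/
def pPlus (β s : ℝ) : ℝ := (1 + Real.tanh (β * s)) / 2

/-- One-step transition kernel of the Glauber dynamics for the Curie-Weiss
model: a uniformly chosen site `i` is refreshed, becoming `+1` with
probability `p₊(S(σ) - σ(i)/n)`. -/
def glauberKernel (β : ℝ) (n : ℕ) (σ η : Config n) : ℝ :=
  (1 / n) * ∑ i : Fin n,
    if ∀ j, j ≠ i → η j = σ j then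
      (if η i then pPlus β (mag σ - spin σ i / n)
       else 1 - pPlus β (mag σ - spin σ i / n))
    else 0

/-- Law of the Glauber dynamics at time `t` started from `σ`. -/
def glauberLaw (β : ℝ) (n : ℕ) : ℕ → Config n → Config n → ℝ
  | 0, σ, η => if η = σ then 1 else 0
  | t + 1, σ, η => ∑ τ : Config n, glauberLaw β n t σ τ * glauberKernel β n τ η

/-- The (normalized) exponent in the Curie-Weiss measure. -/
def cwExponent {n : ℕ} (β : ℝ) (σ : Config n) : ℝ :=
  (β / n) * ∑ i : Fin n, ∑ j : Fin n, if i < j then spin σ i * spin σ j else 0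

/-- The Curie-Weiss (mean-field Ising) probability measure
`μ(σ) = Z(β)⁻¹ exp((β/n) ∑_{i<j} σ(i)σ(j))`. -/
def cwMeasure (β : ℝ) (n : ℕ) (σ : Config n) : ℝ :=
  Real.exp (cwExponent β σ) / ∑ η : Config n, Real.exp (cwExponent β η)

/-- Total variation distance between two (discrete) distributions. -/
def tvDist {Ω : Type*} [Fintype Ω] (μ ν : Ω → ℝ) : ℝ :=
  (∑ x, |μ x - ν x|) / 2

/-- Worst-case total variation distance to stationarity at time `t`. -/
def glauberDist (β : ℝ) (n t : ℕ) : ℝ :=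
  ⨆ σ : Config n, tvDist (glauberLaw β n t σ) (cwMeasure β n)

/-- The heat-bath update at site `i`, acting on observables. -/
def siteUpdate (β : ℝ) {n : ℕ} (i : Fin n) (f : Config n → ℝ) (σ : Config n) : ℝ :=
  pPlus β (mag σ - spin σ i / n) * f (Function.update σ i true) +
    (1 - pPlus β (mag σ - spin σ i / n)) * f (Function.update σ i false)

theorem spin_sq {n : ℕ} (σ : Config n) (i : Fin n) : spin σ i ^ 2 = 1 := by
  unfold spin; split_ifs <;> norm_num

theorem abs_spin {n : ℕ} (σ : Config n) (i : Fin n) : |spin σ i| = 1 := by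
  unfold spin; split_ifs <;> norm_num

theorem sum_spin {n : ℕ} (hn : 0 < n) (σ : Config n) : ∑ i, spin σ i = n * mag σ := by
  unfold mag
  field_simp

theorem abs_mag_le_one {n : ℕ} (hn : 0 < n) (σ : Config n) : |mag σ| ≤ 1 := by
  have hn' : (0 : ℝ) < n := Nat.cast_pos.2 hn
  rw [mag, abs_div, Nat.abs_cast, div_le_one hn']
  calc |∑ i, spin σ i| ≤ ∑ i, |spin σ i| := Finset.abs_sum_le_sum_abs _ _
    _ = n := by simp [abs_spin]

theorem mag_update {n : ℕ} (σ : Config n) (i : Fin n) (b : Bool) :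
    mag (Function.update σ i b) = mag σ - spin σ i / n + (if b then 1 else -1) / n := by
  have h : ∀ τ : Config n, ∑ j, spin τ j = spin τ i + ∑ j ∈ Finset.univ.erase i, spin τ j :=
    fun τ => (Finset.add_sum_erase _ _ (Finset.mem_univ i)).symm
  have h2 : ∑ j ∈ Finset.univ.erase i, spin (Function.update σ i b) j =
      ∑ j ∈ Finset.univ.erase i, spin σ j := by
    refine Finset.sum_congr rfl fun j hj => ?_
    simp [spin, Function.update_of_ne (Finset.ne_of_mem_erase hj)]
  have h3 : spin (Function.update σ i b) i = if b then 1 else -1 := by simp [spin]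
  unfold mag
  rw [h (Function.update σ i b), h2, h σ, h3]
  ring

theorem sum_glauberKernel_mul (β : ℝ) {n : ℕ} (σ : Config n) (f : Config n → ℝ) :
    ∑ η, glauberKernel β n σ η * f η = (1 / n) * ∑ i, siteUpdate β i f σ := by
  simp only [glauberKernel, mul_assoc, Finset.sum_mul]
  rw [← Finset.mul_sum, Finset.sum_comm]
  congr 1
  refine Finset.sum_congr rfl fun i _ => ?_
  have hne : Function.update σ i true ≠ Function.update σ i false := fun h => by
    simpa using congrFun h i
  rw [Finset.sum_eq_add_of_mem _ _ (Finset.mem_univ _) (Finset.mem_univ _) hne]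
  · have h : ∀ b, ∀ j, j ≠ i → Function.update σ i b j = σ j :=
      fun b j hj => Function.update_of_ne hj _ _
    rw [if_pos (h true), if_pos (h false)]
    simp [siteUpdate]
  · rintro η - ⟨h1, h2⟩
    rw [if_neg, zero_mul]
    intro h
    have key : η = Function.update σ i (η i) := by
      funext j
      by_cases hj : j = i
      · subst hj; simp
      · rw [Function.update_of_ne hj, h j hj]
    cases hb : η i
    · exact h2 (by rw [hb] at key; exact key)
    · exact h1 (by rw [hb] at key; exact key)

theorem siteUpdate_const (β : ℝ) {n : ℕ} (i : Fin n) (c : ℝ) (σ : Config n) :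
    siteUpdate β i (fun _ => c) σ = c := by
  unfold siteUpdate; ring

theorem pPlus_nonneg (β s : ℝ) : 0 ≤ pPlus β s := by
  have := Real.neg_one_lt_tanh (β * s)
  unfold pPlus; linarith

theorem pPlus_le_one (β s : ℝ) : pPlus β s ≤ 1 := by
  have := Real.tanh_lt_one (β * s)
  unfold pPlus; linarith

theorem glauberKernel_nonneg (β : ℝ) (n : ℕ) (σ η : Config n) : 0 ≤ glauberKernel β n σ η := by
  refine mul_nonneg (by positivity) (Finset.sum_nonneg fun i _ => ?_)
  split_ifs
  · exact pPlus_nonneg _ _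
  · exact sub_nonneg.2 (pPlus_le_one _ _)
  · exact le_rfl

theorem glauberLaw_nonneg (β : ℝ) (n t : ℕ) (σ η : Config n) : 0 ≤ glauberLaw β n t σ η := by
  induction t generalizing η with
  | zero => unfold glauberLaw; split_ifs <;> norm_num
  | succ t ih =>
    exact Finset.sum_nonneg fun τ _ => mul_nonneg (ih τ) (glauberKernel_nonneg β n τ η)

theorem sum_glauberLaw_zero_mul (β : ℝ) {n : ℕ} (σ : Config n) (f : Config n → ℝ) :
    ∑ η, glauberLaw β n 0 σ η * f η = f σ := by
  simp [glauberLaw]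

theorem sum_glauberLaw_succ_mul (β : ℝ) {n : ℕ} (t : ℕ) (σ : Config n) (f : Config n → ℝ) :
    ∑ η, glauberLaw β n (t + 1) σ η * f η =
      ∑ τ, glauberLaw β n t σ τ * ((1 / n) * ∑ i, siteUpdate β i f τ) := by
  simp only [← sum_glauberKernel_mul]
  simp only [glauberLaw, Finset.sum_mul, Finset.mul_sum, mul_assoc]
  rw [Finset.sum_comm]

theorem sum_glauberLaw (β : ℝ) {n : ℕ} (hn : 0 < n) (t : ℕ) (σ : Config n) :
    ∑ η, glauberLaw β n t σ η = 1 := by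
  have hn' : (n : ℝ) ≠ 0 := by positivity
  induction t with
  | zero => simpa using sum_glauberLaw_zero_mul β σ (fun _ => 1)
  | succ t ih =>
    have h := sum_glauberLaw_succ_mul β t σ (fun _ => 1)
    simpa [siteUpdate_const, hn', ih] using h

theorem cwMeasure_nonneg (β : ℝ) {n : ℕ} (σ : Config n) : 0 ≤ cwMeasure β n σ := by
  unfold cwMeasure; positivity

theorem sum_cwMeasure (β : ℝ) (n : ℕ) : ∑ σ, cwMeasure β n σ = 1 := by
  unfold cwMeasure
  rw [← Finset.sum_div]
  exact div_self (Finset.sum_pos (fun _ _ => Real.exp_pos _) Finset.univ_nonempty).ne'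

theorem cwExponent_eq (β : ℝ) {n : ℕ} (hn : 0 < n) (σ : Config n) :
    cwExponent β σ = β * n / 2 * mag σ ^ 2 - β / 2 := by
  have hn' : (n : ℝ) ≠ 0 := by positivity
  have h1 : (∑ i, spin σ i) ^ 2 =
      2 * (∑ i : Fin n, ∑ j : Fin n, if i < j then spin σ i * spin σ j else 0) + n := by
    have h2 : (∑ i : Fin n, ∑ j : Fin n, if j < i then spin σ i * spin σ j else 0) =
        ∑ i : Fin n, ∑ j : Fin n, if i < j then spin σ i * spin σ j else 0 := by
      rw [Finset.sum_comm]
      simp only [mul_comm]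
    have h3 : (∑ i : Fin n, ∑ j : Fin n, if i = j then spin σ i * spin σ j else 0) = n := by
      simp [← pow_two, spin_sq]
    rw [pow_two, Finset.sum_mul_sum, two_mul]
    nth_rewrite 2 [← h2]
    rw [← h3, ← Finset.sum_add_distrib, ← Finset.sum_add_distrib]
    refine Finset.sum_congr rfl fun i _ => ?_
    rw [← Finset.sum_add_distrib, ← Finset.sum_add_distrib]
    refine Finset.sum_congr rfl fun j _ => ?_
    rcases lt_trichotomy i j with h | h | h
    · simp [h, h.ne, h.not_gt]
    · simp [h]
    · simp [h, h.ne', h.not_gt]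
  rw [sum_spin hn] at h1
  unfold cwExponent
  field_simp
  linear_combination (-β) * h1

theorem sum_config_eq_sum_update {n : ℕ} (i : Fin n) (G : Config n → ℝ) :
    2 * ∑ σ, G σ = ∑ σ : Config n, (G (Function.update σ i true) + G (Function.update σ i false)) := by
  have hinv : Function.Involutive (fun σ : Config n => Function.update σ i (!σ i)) := by
    intro σ; simp
  have h : ∑ σ, G (Function.update σ i (!σ i)) = ∑ σ, G σ :=
    Equiv.sum_comp (hinv.toPerm _) G
  rw [two_mul]
  nth_rewrite 2 [← h]
  rw [← Finset.sum_add_distrib]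
  refine Finset.sum_congr rfl fun σ _ => ?_
  have hs : G (Function.update σ i (σ i)) = G σ := by rw [Function.update_eq_self]
  rw [← hs]
  cases σ i
  · simp [add_comm]
  · simp

theorem sum_cwMeasure_mul_siteUpdate (β : ℝ) {n : ℕ} (hn : 0 < n) (i : Fin n)
    (f : Config n → ℝ) :
    ∑ σ, cwMeasure β n σ * siteUpdate β i f σ = ∑ σ, cwMeasure β n σ * f σ := by
  have hn' : (n : ℝ) ≠ 0 := by positivity
  refine mul_left_cancel₀ (two_ne_zero (α := ℝ)) ?_
  rw [sum_config_eq_sum_update i, sum_config_eq_sum_update i]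
  refine Finset.sum_congr rfl fun σ _ => ?_
  set h := mag σ - spin σ i / n with hh
  have hfield : ∀ b, mag (Function.update σ i b) - spin (Function.update σ i b) i / n = h := by
    intro b
    rw [mag_update]
    cases b <;> simp [spin, hh]
  have hp : cwMeasure β n (Function.update σ i true) * (1 - pPlus β h) =
      cwMeasure β n (Function.update σ i false) * pPlus β h := by
    unfold cwMeasure
    have e1 : cwExponent β (Function.update σ i true) =
        β * n / 2 * (h ^ 2 + 1 / n ^ 2) - β / 2 + β * h := by
      rw [cwExponent_eq β hn, mag_update, ← hh]; simp; field_simp; ring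
    have e2 : cwExponent β (Function.update σ i false) =
        β * n / 2 * (h ^ 2 + 1 / n ^ 2) - β / 2 + -(β * h) := by
      rw [cwExponent_eq β hn, mag_update, ← hh]; simp; field_simp; ring
    rw [e1, e2, Real.exp_add, Real.exp_add, pPlus, Real.tanh_eq_sinh_div_cosh,
      Real.sinh_eq, Real.cosh_eq]
    have := Real.exp_pos (β * h)
    have := Real.exp_pos (-(β * h))
    field_simp
    ring
  simp only [siteUpdate, hfield, Function.update_idem]
  linear_combination (f (Function.update σ i false) - f (Function.update σ i true)) * hp

theorem sinh_le_mul_cosh {x : ℝ} (hx : 0 ≤ x) : Real.sinh x ≤ x * Real.cosh x := by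
  have hd : ∀ y : ℝ, HasDerivAt (fun y => y * Real.cosh y - Real.sinh y) (y * Real.sinh y) y := by
    intro y
    have := ((hasDerivAt_id y).mul (Real.hasDerivAt_cosh y)).sub (Real.hasDerivAt_sinh y)
    refine this.congr_deriv ?_
    simp
  have hmono : MonotoneOn (fun y => y * Real.cosh y - Real.sinh y) (Set.Ici 0) := by
    refine monotoneOn_of_deriv_nonneg (convex_Ici 0)
      (fun y _ => (hd y).continuousAt.continuousWithinAt)
      (fun y _ => (hd y).differentiableAt.differentiableWithinAt) fun y hy => ?_
    rw [interior_Ici] at hy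
    rw [(hd y).deriv]
    exact mul_nonneg (le_of_lt hy) (Real.sinh_nonneg_iff.2 (le_of_lt hy))
  have := hmono (Set.self_mem_Ici) hx hx
  simp at this
  linarith

theorem tanh_le_self {x : ℝ} (hx : 0 ≤ x) : Real.tanh x ≤ x := by
  rw [Real.tanh_eq_sinh_div_cosh, div_le_iff₀ (Real.cosh_pos x)]
  exact sinh_le_mul_cosh hx

theorem mul_tanh_le_sq (x : ℝ) : x * Real.tanh x ≤ x ^ 2 := by
  rcases le_total 0 x with hx | hx
  · nlinarith [tanh_le_self hx]
  · have := tanh_le_self (neg_nonneg.2 hx)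
    rw [Real.tanh_neg] at this
    nlinarith

theorem sub_sq_le_tanh (x : ℝ) : x - x ^ 2 ≤ Real.tanh x := by
  rcases le_total 0 x with hx | hx
  · have he := Real.add_one_le_exp x
    have hpos := Real.exp_pos x
    rw [Real.tanh_eq, Real.exp_neg, le_div_iff₀ (by positivity)]
    have h1 : (x - x ^ 2) * (x + 1) ≤ x := by nlinarith [pow_nonneg hx 3]
    have h2 : x - x ^ 2 ≤ 1 - (Real.exp x)⁻¹ := by
      have h3 : (Real.exp x)⁻¹ ≤ (x + 1)⁻¹ := inv_anti₀ (by linarith) he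
      have h4 : (x - x ^ 2) ≤ x / (x + 1) := (le_div_iff₀ (by linarith)).2 h1
      have h5 : x / (x + 1) = 1 - (x + 1)⁻¹ := by field_simp; ring
      linarith
    have hmul : Real.exp x * (Real.exp x)⁻¹ = 1 := mul_inv_cancel₀ hpos.ne'
    have hinv : 0 < (Real.exp x)⁻¹ := by positivity
    have h6 := mul_le_mul_of_nonneg_right h2 (by positivity : 0 ≤ Real.exp x + (Real.exp x)⁻¹)
    refine h6.trans ?_
    have : (Real.exp x)⁻¹ ≤ 1 := inv_le_one_of_one_le₀ (by linarith)
    nlinarith [sq_nonneg ((Real.exp x)⁻¹ - 1)]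
  · have := tanh_le_self (neg_nonneg.2 hx)
    rw [Real.tanh_neg] at this
    nlinarith

theorem siteUpdate_mag (β : ℝ) {n : ℕ} (i : Fin n) (σ : Config n) :
    siteUpdate β i mag σ =
      mag σ - spin σ i / n + Real.tanh (β * (mag σ - spin σ i / n)) / n := by
  simp only [siteUpdate, mag_update, pPlus]
  simp only [if_true, Bool.false_eq_true, if_false]
  ring

theorem siteUpdate_mag_sq (β : ℝ) {n : ℕ} (i : Fin n) (σ : Config n) :
    siteUpdate β i (fun τ => mag τ ^ 2) σ =
      (mag σ - spin σ i / n) ^ 2 + 1 / n ^ 2 +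
        2 * ((mag σ - spin σ i / n) * Real.tanh (β * (mag σ - spin σ i / n))) / n := by
  simp only [siteUpdate, mag_update, pPlus]
  simp only [if_true, Bool.false_eq_true, if_false]
  ring

theorem sum_localField {n : ℕ} (hn : 0 < n) (σ : Config n) :
    ∑ i, (mag σ - spin σ i / n) = n * mag σ - mag σ := by
  have hn' : (n : ℝ) ≠ 0 := by positivity
  rw [Finset.sum_sub_distrib, ← Finset.sum_div, sum_spin hn]
  simp [hn']

theorem sum_localField_sq {n : ℕ} (hn : 0 < n) (σ : Config n) :
    ∑ i, (mag σ - spin σ i / n) ^ 2 = n * mag σ ^ 2 - 2 * mag σ ^ 2 + 1 / n := by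
  have hn' : (n : ℝ) ≠ 0 := by positivity
  have h : ∀ i, (mag σ - spin σ i / n) ^ 2 =
      mag σ ^ 2 + 1 / (n : ℝ) ^ 2 - 2 * mag σ / n * spin σ i := by
    intro i
    have := spin_sq σ i
    field_simp
    linear_combination this
  rw [Finset.sum_congr rfl fun i _ => h i, Finset.sum_sub_distrib, ← Finset.mul_sum, sum_spin hn]
  simp
  field_simp
  ring

theorem drift_mag_ge {β : ℝ} (hβ0 : 0 ≤ β) (hβ1 : β < 1) {n : ℕ} (hn : 0 < n) (σ : Config n) :
    (1 - (1 - β) / n) * mag σ - mag σ ^ 2 / n - 2 / n ^ 2 ≤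
      (1 / n) * ∑ i, siteUpdate β i mag σ := by
  have hn' : (0 : ℝ) < n := Nat.cast_pos.2 hn
  have hn1 : (1 : ℝ) ≤ n := by exact_mod_cast hn
  have h1 : ∀ i, (mag σ - spin σ i / n) + (β * (mag σ - spin σ i / n) -
      (mag σ - spin σ i / n) ^ 2) / n ≤ siteUpdate β i mag σ := by
    intro i
    rw [siteUpdate_mag]
    gcongr
    refine le_trans ?_ (sub_sq_le_tanh _)
    have : β ^ 2 * (mag σ - spin σ i / n) ^ 2 ≤ 1 * (mag σ - spin σ i / n) ^ 2 := by
      gcongr; nlinarith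
    rw [mul_pow]; linarith
  have h2 := Finset.sum_le_sum fun i (_ : i ∈ Finset.univ) => h1 i
  rw [Finset.sum_add_distrib, sum_localField hn, ← Finset.sum_div, Finset.sum_sub_distrib,
    ← Finset.mul_sum, sum_localField hn, sum_localField_sq hn] at h2
  refine le_trans ?_ (mul_le_mul_of_nonneg_left h2 (by positivity))
  have habs := abs_le.1 (abs_mag_le_one hn σ)
  have hle : β * mag σ ≤ 1 := by nlinarith
  have hinv : 1 / (n : ℝ) ≤ 1 := by rw [div_le_one hn']; exact hn1
  have key : (1 / (n : ℝ)) * (n * mag σ - mag σ + (β * (n * mag σ - mag σ) -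
      (n * mag σ ^ 2 - 2 * mag σ ^ 2 + 1 / n)) / n) -
      ((1 - (1 - β) / n) * mag σ - mag σ ^ 2 / n - 2 / n ^ 2) =
      (2 - β * mag σ + 2 * mag σ ^ 2 - 1 / n) / n ^ 2 := by
    field_simp; ring
  have : 0 ≤ (2 - β * mag σ + 2 * mag σ ^ 2 - 1 / n) / (n : ℝ) ^ 2 :=
    div_nonneg (by nlinarith [sq_nonneg (mag σ)]) (by positivity)
  linarith

theorem drift_mag_sq_le {β : ℝ} (hβ0 : 0 ≤ β) (hβ1 : β < 1) {n : ℕ} (hn : 0 < n)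
    (σ : Config n) :
    (1 / n) * ∑ i, siteUpdate β i (fun τ => mag τ ^ 2) σ ≤
      (1 - 2 * (1 - β) / n) * mag σ ^ 2 + 4 / n ^ 2 := by
  have hn' : (0 : ℝ) < n := Nat.cast_pos.2 hn
  have hn1 : (1 : ℝ) ≤ n := by exact_mod_cast hn
  have h1 : ∀ i, siteUpdate β i (fun τ => mag τ ^ 2) σ ≤
      (1 + 2 * β / n) * (mag σ - spin σ i / n) ^ 2 + 1 / n ^ 2 := by
    intro i
    rw [siteUpdate_mag_sq]
    set h := mag σ - spin σ i / n
    have : h * Real.tanh (β * h) ≤ β * h ^ 2 := by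
      rcases hβ0.eq_or_lt with rfl | hpos
      · simp
      · have := mul_tanh_le_sq (β * h)
        refine le_of_mul_le_mul_left ?_ hpos
        nlinarith
    have h3 : 2 * (h * Real.tanh (β * h)) / n ≤ 2 * (β * h ^ 2) / n := by gcongr
    have h4 : (1 + 2 * β / n) * h ^ 2 + 1 / (n : ℝ) ^ 2 =
      h ^ 2 + 1 / n ^ 2 + 2 * (β * h ^ 2) / n := by ring
    linarith
  have h2 := Finset.sum_le_sum fun i (_ : i ∈ Finset.univ) => h1 i
  rw [Finset.sum_add_distrib, ← Finset.mul_sum, sum_localField_sq hn] at h2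
  refine (mul_le_mul_of_nonneg_left h2 (by positivity)).trans ?_
  simp only [Finset.sum_const, Finset.card_univ, Fintype.card_fin, nsmul_eq_mul]
  have key : ((1 - 2 * (1 - β) / n) * mag σ ^ 2 + 4 / n ^ 2) -
      (1 / (n : ℝ)) * ((1 + 2 * β / n) * (n * mag σ ^ 2 - 2 * mag σ ^ 2 + 1 / n) +
        n * (1 / n ^ 2)) = (2 - 2 * β * (1 / n) + 4 * β * mag σ ^ 2) / n ^ 2 := by
    field_simp; ring
  have hinv : 1 / (n : ℝ) ≤ 1 := by rw [div_le_one hn']; exact hn1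
  have hinv0 : 0 ≤ 1 / (n : ℝ) := by positivity
  have : 0 ≤ (2 - 2 * β * (1 / n) + 4 * β * mag σ ^ 2) / (n : ℝ) ^ 2 :=
    div_nonneg (by nlinarith [mul_nonneg hβ0 (sq_nonneg (mag σ))]) (by positivity)
  linarith

theorem sum_cwMeasure_mul_mag_sq_le {β : ℝ} (hβ0 : 0 ≤ β) (hβ1 : β < 1) {n : ℕ} (hn : 0 < n) :
    ∑ σ, cwMeasure β n σ * mag σ ^ 2 ≤ 4 / (1 - β) / n := by
  have hn' : (0 : ℝ) < n := Nat.cast_pos.2 hn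
  have hr : 0 < 1 - β := by linarith
  have h1 : ∑ σ, cwMeasure β n σ * ((1 / n) * ∑ i, siteUpdate β i (fun τ => mag τ ^ 2) σ) =
      ∑ σ, cwMeasure β n σ * mag σ ^ 2 := by
    simp only [Finset.mul_sum, mul_left_comm _ (1 / (n : ℝ))]
    rw [Finset.sum_comm]
    simp only [← Finset.mul_sum, sum_cwMeasure_mul_siteUpdate β hn]
    simp
    field_simp
  have h2 := Finset.sum_le_sum fun σ (_ : σ ∈ Finset.univ) =>
    mul_le_mul_of_nonneg_left (drift_mag_sq_le hβ0 hβ1 hn σ) (cwMeasure_nonneg β σ)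
  rw [h1] at h2
  simp only [mul_add, mul_left_comm _ (1 - 2 * (1 - β) / (n : ℝ))] at h2
  rw [Finset.sum_add_distrib, ← Finset.mul_sum, ← Finset.sum_mul, sum_cwMeasure] at h2
  set M := ∑ σ, cwMeasure β n σ * mag σ ^ 2
  have h3 : 2 * (1 - β) / n * M ≤ 4 / n ^ 2 := by linarith
  rw [div_div, le_div_iff₀ (by positivity)]
  have h4 : M * ((1 - β) * n) = (2 * (1 - β) / n * M) * n ^ 2 / 2 := by field_simp
  rw [h4]
  calc (2 * (1 - β) / n * M) * n ^ 2 / 2 ≤ (4 / n ^ 2) * n ^ 2 / 2 := by gcongr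
    _ = 2 := by field_simp; norm_num
    _ ≤ 4 := by norm_num

theorem sum_glauberLaw_succ_mul_mag_ge {β : ℝ} (hβ0 : 0 ≤ β) (hβ1 : β < 1) {n : ℕ} (hn : 0 < n)
    (t : ℕ) (σ : Config n) :
    (1 - (1 - β) / n) * ∑ η, glauberLaw β n t σ η * mag η -
        (∑ η, glauberLaw β n t σ η * mag η ^ 2) / n - 2 / n ^ 2 ≤
      ∑ η, glauberLaw β n (t + 1) σ η * mag η := by
  rw [sum_glauberLaw_succ_mul]
  refine le_trans (le_of_eq ?_) (Finset.sum_le_sum fun η (_ : η ∈ Finset.univ) =>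
    mul_le_mul_of_nonneg_left (drift_mag_ge hβ0 hβ1 hn η) (glauberLaw_nonneg β n t σ η))
  simp only [mul_sub]
  rw [Finset.sum_sub_distrib, Finset.sum_sub_distrib, ← Finset.sum_mul, sum_glauberLaw β hn,
    Finset.mul_sum, Finset.sum_div, one_mul]
  congr 2
  · exact Finset.sum_congr rfl fun η _ => by ring
  · exact Finset.sum_congr rfl fun η _ => by ring

theorem sum_glauberLaw_succ_mul_mag_sq_le {β : ℝ} (hβ0 : 0 ≤ β) (hβ1 : β < 1) {n : ℕ}
    (hn : 0 < n) (t : ℕ) (σ : Config n) :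
    ∑ η, glauberLaw β n (t + 1) σ η * mag η ^ 2 ≤
      (1 - 2 * (1 - β) / n) * ∑ η, glauberLaw β n t σ η * mag η ^ 2 + 4 / n ^ 2 := by
  rw [sum_glauberLaw_succ_mul β t σ (fun η => mag η ^ 2)]
  refine le_trans (Finset.sum_le_sum fun η (_ : η ∈ Finset.univ) =>
    mul_le_mul_of_nonneg_left (drift_mag_sq_le hβ0 hβ1 hn η) (glauberLaw_nonneg β n t σ η))
    (le_of_eq ?_)
  simp only [mul_add]
  rw [Finset.sum_add_distrib, ← Finset.sum_mul, sum_glauberLaw β hn, Finset.mul_sum, one_mul]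
  congr 1
  exact Finset.sum_congr rfl fun η _ => by ring

theorem second_moment_recursion {r N : ℝ} (hr0 : 0 < r) (hr1 : r ≤ 1) (hN : 2 ≤ N) {b : ℕ → ℝ}
    (hb0 : ∀ t, 0 ≤ b t) (hb : ∀ t, b (t + 1) ≤ (1 - 2 * r / N) * b t + 4 / N ^ 2) (t : ℕ) :
    b t ≤ ((1 - r / N) ^ t) ^ 2 * b 0 + 4 / r / N := by
  have hN0 : 0 < N := by linarith
  induction t with
  | zero => simp; positivity
  | succ t ih =>
    have h1 : (1 - 2 * r / N) * b t ≤ (1 - r / N) ^ 2 * b t := by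
      refine mul_le_mul_of_nonneg_right ?_ (hb0 t)
      have : (1 - r / N) ^ 2 = 1 - 2 * r / N + (r / N) ^ 2 := by ring
      nlinarith [sq_nonneg (r / N)]
    have h2 := mul_le_mul_of_nonneg_left ih (sq_nonneg (1 - r / N))
    have h3 : 4 / r / N - ((1 - r / N) ^ 2 * (4 / r / N) + 4 / N ^ 2) =
        4 * (N - r) / N ^ 3 := by field_simp; ring
    have h4 : 0 ≤ 4 * (N - r) / N ^ 3 := div_nonneg (by linarith) (by positivity)
    have h5 : ((1 - r / N) ^ (t + 1)) ^ 2 * b 0 =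
        (1 - r / N) ^ 2 * (((1 - r / N) ^ t) ^ 2 * b 0) := by ring
    have := hb t
    rw [h5]
    linarith

theorem first_moment_recursion {r N s : ℝ} (hr0 : 0 < r) (hr1 : r ≤ 1) (hN : 2 ≤ N)
    {a b : ℕ → ℝ} (ha0 : a 0 = s)
    (hb : ∀ t, b t ≤ ((1 - r / N) ^ t) ^ 2 * s ^ 2 + 4 / r / N)
    (ha : ∀ t, (1 - r / N) * a t - b t / N - 2 / N ^ 2 ≤ a (t + 1)) (t : ℕ) :
    (1 - r / N) ^ t * (s - 2 / r * s ^ 2) - (4 / r + 2) / r / N ≤ a t := by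
  have hN0 : 0 < N := by linarith
  have hrN : r / N ≤ 1 / 2 := by rw [div_le_iff₀ hN0]; linarith
  have hrho : 1 / 2 ≤ 1 - r / N := by linarith
  suffices h : (1 - r / N) ^ t * (s - 2 / r * s ^ 2 * (1 - (1 - r / N) ^ t)) -
      (4 / r + 2) / r / N ≤ a t by
    refine le_trans ?_ h
    have hpos : 0 ≤ (1 - r / N) ^ t := by positivity
    have : 0 ≤ (1 - r / N) ^ t * (2 / r * s ^ 2 * (1 - r / N) ^ t) := by positivity
    linarith
  induction t with
  | zero => simp [ha0]; positivity
  | succ t ih =>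
    have h1 := mul_le_mul_of_nonneg_left ih (by linarith : 0 ≤ 1 - r / N)
    have h2 := ha t
    have h3 : b t / N ≤ (((1 - r / N) ^ t) ^ 2 * s ^ 2 + 4 / r / N) / N := by
      gcongr; exact hb t
    have key : (1 - r / N) * ((1 - r / N) ^ t * (s - 2 / r * s ^ 2 * (1 - (1 - r / N) ^ t)) -
        (4 / r + 2) / r / N) - (((1 - r / N) ^ t) ^ 2 * s ^ 2 + 4 / r / N) / N - 2 / N ^ 2 -
        ((1 - r / N) ^ (t + 1) * (s - 2 / r * s ^ 2 * (1 - (1 - r / N) ^ (t + 1))) -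
      (4 / r + 2) / r / N) = ((1 - r / N) ^ t) ^ 2 * s ^ 2 / N * (2 * (1 - r / N) - 1) := by
      rw [pow_succ (1 - r / N) t]
      generalize (1 - r / N) ^ t = z
      field_simp
      ring
    have h4 : 0 ≤ ((1 - r / N) ^ t) ^ 2 * s ^ 2 / N * (2 * (1 - r / N) - 1) :=
      mul_nonneg (by positivity) (by linarith)
    linarith

theorem tvDist_ge {Ω : Type*} [Fintype Ω] {p q : Ω → ℝ} (hp0 : ∀ x, 0 ≤ p x)
    (hq0 : ∀ x, 0 ≤ q x) (hp : ∑ x, p x = 1) (hq : ∑ x, q x = 1) (f : Ω → ℝ) {a : ℝ}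
    (ha : 0 < a) (hmean : ∑ x, p x * f x = a) :
    1 - 4 * ((∑ x, p x * f x ^ 2) - a ^ 2 + ∑ x, q x * f x ^ 2) / a ^ 2 ≤ tvDist p q := by
  have hvar : ∑ x, p x * (f x - a) ^ 2 = (∑ x, p x * f x ^ 2) - a ^ 2 := by
    have : ∀ x, p x * (f x - a) ^ 2 = p x * f x ^ 2 - 2 * a * (p x * f x) + a ^ 2 * p x :=
      fun x => by ring
    rw [Finset.sum_congr rfl fun x _ => this x, Finset.sum_add_distrib, Finset.sum_sub_distrib,
      ← Finset.mul_sum, ← Finset.mul_sum, hmean, hp]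
    ring
  have hpt : ∀ x, p x + q x - 8 / a ^ 2 * (p x * (f x - a) ^ 2 + q x * f x ^ 2) ≤
      |p x - q x| := by
    intro x
    rcases le_total (f x) (a / 2) with h | h
    · have h1 : 1 ≤ 4 / a ^ 2 * (f x - a) ^ 2 := by
        rw [div_mul_eq_mul_div, le_div_iff₀ (by positivity)]
        nlinarith
      have h2 : 0 ≤ 8 / a ^ 2 * (q x * f x ^ 2) := by have := hq0 x; positivity
      have h3 := mul_le_mul_of_nonneg_left h1 (hp0 x)
      have h4 := neg_abs_le (p x - q x)
      have h5 : 8 / a ^ 2 * (p x * (f x - a) ^ 2) = 2 * (p x * (4 / a ^ 2 * (f x - a) ^ 2)) := by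
        ring
      linarith
    · have h1 : 1 ≤ 4 / a ^ 2 * f x ^ 2 := by
        rw [div_mul_eq_mul_div, le_div_iff₀ (by positivity)]
        nlinarith
      have h2 : 0 ≤ 8 / a ^ 2 * (p x * (f x - a) ^ 2) := by have := hp0 x; positivity
      have h3 := mul_le_mul_of_nonneg_left h1 (hq0 x)
      have h4 := le_abs_self (p x - q x)
      have h5 : 8 / a ^ 2 * (q x * f x ^ 2) = 2 * (q x * (4 / a ^ 2 * f x ^ 2)) := by
        ring
      linarith
  have hsum := Finset.sum_le_sum fun x (_ : x ∈ Finset.univ) => hpt x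
  rw [Finset.sum_sub_distrib, Finset.sum_add_distrib, ← Finset.mul_sum, Finset.sum_add_distrib,
    hp, hq, hvar] at hsum
  unfold tvDist
  rw [le_div_iff₀ two_pos]
  refine le_trans (le_of_eq ?_) hsum
  ring

theorem tvDist_le_one {Ω : Type*} [Fintype Ω] {p q : Ω → ℝ} (hp0 : ∀ x, 0 ≤ p x)
    (hq0 : ∀ x, 0 ≤ q x) (hp : ∑ x, p x = 1) (hq : ∑ x, q x = 1) : tvDist p q ≤ 1 := by
  have h : ∑ x, |p x - q x| ≤ ∑ x, (p x + q x) := Finset.sum_le_sum fun x _ =>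
    abs_le.2 ⟨by linarith [hp0 x, hq0 x], by linarith [hp0 x, hq0 x]⟩
  rw [Finset.sum_add_distrib, hp, hq] at h
  unfold tvDist
  linarith

theorem glauberDist_le_one (β : ℝ) {n : ℕ} (hn : 0 < n) (t : ℕ) : glauberDist β n t ≤ 1 :=
  ciSup_le fun σ => tvDist_le_one (glauberLaw_nonneg β n t σ) (fun η => cwMeasure_nonneg β η)
    (sum_glauberLaw β hn t σ) (sum_cwMeasure β n)

theorem glauberDist_nonneg (β : ℝ) (n t : ℕ) : 0 ≤ glauberDist β n t :=
  Real.iSup_nonneg fun _ => div_nonneg (Finset.sum_nonneg fun _ _ => abs_nonneg _) two_pos.le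

theorem le_glauberDist (β : ℝ) (n t : ℕ) (σ : Config n) :
    tvDist (glauberLaw β n t σ) (cwMeasure β n) ≤ glauberDist β n t :=
  le_ciSup (f := fun σ => tvDist (glauberLaw β n t σ) (cwMeasure β n))
    (Set.finite_range _).bddAbove σ

theorem normalized_variance_bound {N x s m K D F a b w : ℝ} (hN : 1 ≤ N) (hs : 0 < s)
    (hx : 0 < x) (hK : 0 ≤ K) (hD : 0 ≤ D) (hF : 0 ≤ F) (hm : m = s - K * s ^ 2)
    (hKs : K * s ≤ 1 / 2) (hFx : 4 * F ≤ x * s)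
    (ha : x * m - F ≤ √N * a) (hb : N * b ≤ x ^ 2 * s ^ 2 + D) (hw : N * w ≤ D) :
    0 < a ∧ 4 * (b - a ^ 2 + w) / a ^ 2 ≤
      128 * (K * s) + 128 * D / (x * s) ^ 2 + 128 * F / (x * s) := by
  have hy : 0 < x * s := mul_pos hx hs
  have hsqrt : 0 < √N := Real.sqrt_pos.2 (by linarith)
  have hm1 : x * s / 2 ≤ x * m := by rw [hm]; nlinarith
  have hA : x * s / 4 ≤ √N * a := by linarith
  have ha0 : 0 < a := by
    by_contra h
    have := mul_nonpos_of_nonneg_of_nonpos hsqrt.le (not_lt.1 h)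
    linarith
  refine ⟨ha0, ?_⟩
  have hsq : (√N * a) ^ 2 = N * a ^ 2 := by rw [mul_pow, Real.sq_sqrt (by linarith)]
  have h1 : (x * m - F) ^ 2 ≤ N * a ^ 2 := by
    rw [← hsq]; exact pow_le_pow_left₀ (by linarith) ha 2
  have h2 : (x * s) ^ 2 / 16 ≤ N * a ^ 2 := by
    rw [← hsq]
    calc (x * s) ^ 2 / 16 = (x * s / 4) ^ 2 := by ring
      _ ≤ _ := pow_le_pow_left₀ (by positivity) hA 2
  have h3 : N * (b - a ^ 2 + w) ≤ 2 * (K * s) * (x * s) ^ 2 + 2 * D + 2 * (x * s) * F := by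
    have h4 : (x * m - F) ^ 2 = (x * s) ^ 2 - 2 * (K * s) * (x * s) ^ 2 - 2 * (x * s) * F +
        ((K * s) ^ 2 * (x * s) ^ 2 + 2 * (K * s) * (x * s) * F + F ^ 2) := by
      rw [hm]; ring
    have h5 : 0 ≤ (K * s) ^ 2 * (x * s) ^ 2 + 2 * (K * s) * (x * s) * F + F ^ 2 := by positivity
    nlinarith
  have h6 : 4 * (b - a ^ 2 + w) / a ^ 2 = 4 * (N * (b - a ^ 2 + w)) / (N * a ^ 2) := by
    have : N ≠ 0 := by linarith
    field_simp
  rw [h6]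
  calc 4 * (N * (b - a ^ 2 + w)) / (N * a ^ 2)
      ≤ 4 * (2 * (K * s) * (x * s) ^ 2 + 2 * D + 2 * (x * s) * F) / (N * a ^ 2) := by
        gcongr
    _ ≤ 4 * (2 * (K * s) * (x * s) ^ 2 + 2 * D + 2 * (x * s) * F) / ((x * s) ^ 2 / 16) := by
        gcongr
    _ = _ := by field_simp; ring

theorem tvDist_glauberLaw_ge {β : ℝ} (hβ0 : 0 ≤ β) (hβ1 : β < 1) {n : ℕ} (hn : 2 ≤ n) (t : ℕ)
    (σ : Config n) (hs : 0 < mag σ) (hKs : 2 / (1 - β) * mag σ ≤ 1 / 2)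
    (hx : 4 * ((4 / (1 - β) + 2) / (1 - β)) ≤ (1 - (1 - β) / n) ^ t * √n * mag σ) :
    1 - (128 * (2 / (1 - β) * mag σ) +
        128 * (4 / (1 - β)) / ((1 - (1 - β) / n) ^ t * √n * mag σ) ^ 2 +
        128 * ((4 / (1 - β) + 2) / (1 - β)) / ((1 - (1 - β) / n) ^ t * √n * mag σ)) ≤
      tvDist (glauberLaw β n t σ) (cwMeasure β n) := by
  have hr0 : 0 < 1 - β := by linarith
  have hr1 : 1 - β ≤ 1 := by linarith
  have hn0 : 0 < n := by omega
  have hN : (2 : ℝ) ≤ n := by exact_mod_cast hn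
  have hN0 : (0 : ℝ) < n := by linarith
  have hrho : 0 < 1 - (1 - β) / (n : ℝ) := by
    rw [sub_pos, div_lt_one hN0]; linarith
  have hb := second_moment_recursion hr0 hr1 hN
    (b := fun t => ∑ η, glauberLaw β n t σ η * mag η ^ 2)
    (fun t => Finset.sum_nonneg fun η _ => mul_nonneg (glauberLaw_nonneg β n t σ η) (sq_nonneg _))
    (fun t => sum_glauberLaw_succ_mul_mag_sq_le hβ0 hβ1 hn0 t σ)
  have hinit : ∑ η, glauberLaw β n 0 σ η * mag η ^ 2 = mag σ ^ 2 :=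
    sum_glauberLaw_zero_mul β σ (fun η => mag η ^ 2)
  simp only [hinit] at hb
  have ha := first_moment_recursion hr0 hr1 hN
    (a := fun t => ∑ η, glauberLaw β n t σ η * mag η) (sum_glauberLaw_zero_mul β σ mag) hb
    (fun t => sum_glauberLaw_succ_mul_mag_ge hβ0 hβ1 hn0 t σ) t
  have hbt := hb t
  have hw := sum_cwMeasure_mul_mag_sq_le hβ0 hβ1 hn0
  have hsqrt1 : 1 ≤ √(n : ℝ) := Real.one_le_sqrt.2 (by linarith)
  have hsqrt : √(n : ℝ) * √n = n := Real.mul_self_sqrt hN0.le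
  have hpow : 0 < (1 - (1 - β) / (n : ℝ)) ^ t := pow_pos hrho t
  obtain ⟨hpos, hle⟩ := normalized_variance_bound
    (N := n) (x := (1 - (1 - β) / n) ^ t * √n) (s := mag σ) (m := mag σ - 2 / (1 - β) * mag σ ^ 2)
    (K := 2 / (1 - β)) (D := 4 / (1 - β)) (F := (4 / (1 - β) + 2) / (1 - β))
    (a := ∑ η, glauberLaw β n t σ η * mag η) (b := ∑ η, glauberLaw β n t σ η * mag η ^ 2)
    (w := ∑ η, cwMeasure β n η * mag η ^ 2) (by linarith) hs (by positivity) (by positivity)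
    (by positivity) (by positivity) rfl hKs hx
    (by
      have h1 := mul_le_mul_of_nonneg_left ha (Real.sqrt_nonneg (n : ℝ))
      refine le_trans ?_ h1
      have h2 : √(n : ℝ) * ((4 / (1 - β) + 2) / (1 - β) / n) ≤ (4 / (1 - β) + 2) / (1 - β) := by
        rw [mul_div_assoc', div_le_iff₀ hN0, mul_comm]
        gcongr
        nlinarith
      linarith)
    (by
      have h1 := mul_le_mul_of_nonneg_left hbt hN0.le
      refine h1.trans (le_of_eq ?_)
      rw [mul_pow ((1 - (1 - β) / (n : ℝ)) ^ t), Real.sq_sqrt hN0.le]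
      field_simp)
    (by
      have h1 := mul_le_mul_of_nonneg_left hw hN0.le
      refine h1.trans (le_of_eq ?_)
      field_simp)
  have := tvDist_ge (glauberLaw_nonneg β n t σ) (fun η => cwMeasure_nonneg β η)
    (sum_glauberLaw β hn0 t σ) (sum_cwMeasure β n) mag hpos rfl
  linarith

theorem exists_mag_mem_Icc {ε : ℝ} (hε0 : 0 < ε) (hε1 : ε ≤ 1 / 2) {n : ℕ} (hn : 2 ≤ n * ε) :
    ∃ σ : Config n, ε ≤ mag σ ∧ mag σ ≤ 2 * ε := by
  have hN0 : (0 : ℝ) < n := by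
    by_contra h
    have := mul_nonpos_of_nonpos_of_nonneg (not_lt.1 h) hε0.le
    linarith
  set k := ⌈(n : ℝ) * (1 + ε) / 2⌉₊ with hk
  have hk1 : (n : ℝ) * (1 + ε) / 2 ≤ k := Nat.le_ceil _
  have hk2 : (k : ℝ) < n * (1 + ε) / 2 + 1 := Nat.ceil_lt_add_one (by positivity)
  have hkn : k ≤ n := by
    have : (k : ℝ) ≤ n := by nlinarith
    exact_mod_cast this
  obtain ⟨s, -, hs⟩ := Finset.exists_subset_card_eq (s := (Finset.univ : Finset (Fin n))) (n := k)
    (by simpa using hkn)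
  refine ⟨fun i => decide (i ∈ s), ?_⟩
  have hsum : ∑ i, spin (fun i : Fin n => decide (i ∈ s)) i = 2 * k - n := by
    have : ∀ i, spin (fun i : Fin n => decide (i ∈ s)) i = 2 * (if i ∈ s then 1 else 0) - 1 := by
      intro i
      by_cases h : i ∈ s <;> simp [spin, h]; norm_num
    simp only [this, Finset.sum_sub_distrib, ← Finset.mul_sum]
    simp [hs]
  unfold mag
  rw [hsum]
  exact ⟨(le_div_iff₀ hN0).2 (by linarith), (div_le_iff₀ hN0).2 (by linarith)⟩

theorem exp_le_pow_floor_mul_sqrt {r γ : ℝ} (hr0 : 0 < r) (hr1 : r ≤ 1) (hγ : 0 ≤ γ) {n : ℕ}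
    (hn : 2 ≤ n) (hT : 0 ≤ (n : ℝ) * Real.log n / (2 * r) - γ * n) :
    Real.exp (r * γ - 1) ≤
      (1 - r / n) ^ ⌊(n : ℝ) * Real.log n / (2 * r) - γ * n⌋₊ * √n := by
  have hN : (2 : ℝ) ≤ n := by exact_mod_cast hn
  have hN0 : (0 : ℝ) < n := by linarith
  set T := ⌊(n : ℝ) * Real.log n / (2 * r) - γ * n⌋₊
  have hTle : (T : ℝ) ≤ n * Real.log n / (2 * r) - γ * n := Nat.floor_le hT
  have hy0 : 0 < r / n := by positivity
  have hy : r / n ≤ 1 / 2 := by rw [div_le_iff₀ hN0]; linarith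
  have hlog : -(r / n) - 2 * (r / n) ^ 2 ≤ Real.log (1 - r / n) := by
    refine le_trans ?_ (Real.one_sub_inv_le_log_of_pos (by linarith : 0 < 1 - r / (n : ℝ)))
    set y := r / (n : ℝ)
    have h1 : (1 - y)⁻¹ ≤ 1 + y + 2 * y ^ 2 := by
      rw [inv_le_iff_one_le_mul₀ (by linarith)]
      nlinarith [sq_nonneg y]
    linarith
  have hlogn : Real.log n ≤ n := (Real.log_le_sub_one_of_pos hN0).trans (by linarith)
  have hexp : (1 - r / (n : ℝ)) ^ T * √n =
      Real.exp (T * Real.log (1 - r / n) + Real.log n / 2) := by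
    rw [Real.exp_add, ← Real.log_sqrt hN0.le, Real.exp_log (Real.sqrt_pos.2 hN0),
      Real.exp_nat_mul, Real.exp_log (by linarith)]
  rw [hexp]
  refine Real.exp_le_exp.2 ?_
  have h1 : (T : ℝ) * (-(r / n) - 2 * (r / n) ^ 2) ≤ T * Real.log (1 - r / n) := by gcongr
  have h2 : (T : ℝ) * (r / n) ≤ Real.log n / 2 - r * γ := by
    calc (T : ℝ) * (r / n) ≤ (n * Real.log n / (2 * r) - γ * n) * (r / n) := by gcongr
      _ = _ := by field_simp
  have h3 : (T : ℝ) * (2 * (r / n) ^ 2) ≤ 1 := by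
    calc (T : ℝ) * (2 * (r / n) ^ 2) ≤ (n * Real.log n / (2 * r)) * (2 * (r / n) ^ 2) := by
          gcongr
          have := mul_nonneg hγ hN0.le
          linarith
      _ = r * Real.log n / n := by field_simp
      _ ≤ 1 := by
        rw [div_le_one hN0]
        have : 0 ≤ Real.log n := Real.log_nonneg (by linarith)
        nlinarith
  linarith

theorem eventually_le_glauberDist {β : ℝ} (hβ0 : 0 ≤ β) (hβ1 : β < 1) {δ : ℝ} (hδ0 : 0 < δ)
    (hδ1 : δ ≤ 1) :
    ∀ᶠ γ : ℝ in atTop, ∀ᶠ n : ℕ in atTop, 1 - δ ≤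
      glauberDist β n ⌊(n : ℝ) * Real.log n / (2 * (1 - β)) - γ * n⌋₊ := by
  have hr0 : 0 < 1 - β := by linarith
  have hr1 : 1 - β ≤ 1 := by linarith
  set r := 1 - β with hr
  set D := 4 / r with hD
  set F := (4 / r + 2) / r with hF
  have hD0 : 0 < D := by positivity
  have hF0 : 0 < F := by positivity
  set ε := δ * r / 2048 with hε
  have hε0 : 0 < ε := by positivity
  have hε1 : ε ≤ 1 / 2 := by rw [hε]; nlinarith
  set Y := 1 + 4 * F + 256 * (D + F) / δ with hY
  have hexp : Tendsto (fun γ : ℝ => Real.exp (r * γ - 1) * ε) atTop atTop := by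
    refine Tendsto.atTop_mul_const hε0 (Real.tendsto_exp_atTop.comp ?_)
    exact tendsto_atTop_add_const_right _ _ (tendsto_id.const_mul_atTop hr0)
  filter_upwards [hexp.eventually_ge_atTop Y, eventually_ge_atTop 0] with γ hγY hγ0
  have hlog : Tendsto (fun n : ℕ => Real.log n) atTop atTop :=
    Real.tendsto_log_atTop.comp tendsto_natCast_atTop_atTop
  have hnat : Tendsto (fun n : ℕ => (n : ℝ) * ε) atTop atTop :=
    tendsto_natCast_atTop_atTop.atTop_mul_const hε0
  filter_upwards [eventually_ge_atTop 2, hlog.eventually_ge_atTop (γ * (2 * r)),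
    hnat.eventually_ge_atTop 2] with n hn hlogn hnε
  have hT : 0 ≤ (n : ℝ) * Real.log n / (2 * r) - γ * n := by
    rw [sub_nonneg, le_div_iff₀ (by positivity)]
    nlinarith [(Nat.cast_nonneg n : (0 : ℝ) ≤ n)]
  have hx := exp_le_pow_floor_mul_sqrt hr0 hr1 hγ0 hn hT
  obtain ⟨σ, hσ1, hσ2⟩ := exists_mag_mem_Icc hε0 hε1 hnε
  refine le_trans ?_ (le_glauberDist β n _ σ)
  set T := ⌊(n : ℝ) * Real.log n / (2 * r) - γ * n⌋₊
  set y := (1 - r / n) ^ T * √n * mag σ with hy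
  have hyY : Y ≤ y := hγY.trans (mul_le_mul hx hσ1 hε0.le ((Real.exp_pos _).le.trans hx))
  have hY1 : 0 < 256 * (D + F) / δ := by positivity
  have hKs : 2 / r * mag σ ≤ δ / 512 := by
    calc 2 / r * mag σ ≤ 2 / r * (2 * ε) := by gcongr
      _ = δ / 512 := by rw [hε]; field_simp; norm_num
  refine le_trans ?_ (tvDist_glauberLaw_ge hβ0 hβ1 hn T σ (hε0.trans_le hσ1) (by linarith)
    (by linarith))
  have hy1 : 1 ≤ y := by linarith
  have h1 : 128 * D / y ^ 2 ≤ 128 * D / y := by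
    gcongr
    nlinarith
  have h2 : 128 * D / y + 128 * F / y ≤ δ / 2 := by
    rw [← add_div, div_le_iff₀ (by linarith)]
    have h3 : 256 * (D + F) / δ ≤ y := by linarith
    rw [div_le_iff₀ hδ0] at h3
    linarith
  linarith

/-- Lower bound in the high-temperature cut-off: for `0 ≤ β < 1`,
`lim_{γ→∞} liminf_{n→∞} dₙ(n log n / (2(1-β)) - γn) = 1`. -/
theorem cw_cutoff_lower (β : ℝ) (hβ0 : 0 ≤ β) (hβ1 : β < 1) :
    Tendsto (fun γ : ℝ =>
        liminf (fun n : ℕ =>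
          glauberDist β n ⌊(n : ℝ) * Real.log n / (2 * (1 - β)) - γ * n⌋₊) atTop)
      atTop (nhds 1) := by
  have hub : ∀ γ : ℝ, ∀ᶠ n : ℕ in atTop,
      glauberDist β n ⌊(n : ℝ) * Real.log n / (2 * (1 - β)) - γ * n⌋₊ ≤ 1 := fun γ => by
    filter_upwards [eventually_gt_atTop 0] with n hn using glauberDist_le_one β hn _
  have hbelow : ∀ γ : ℝ, atTop.IsBoundedUnder (· ≥ ·) fun n : ℕ =>
      glauberDist β n ⌊(n : ℝ) * Real.log n / (2 * (1 - β)) - γ * n⌋₊ := fun γ =>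
    isBoundedUnder_of ⟨0, fun n : ℕ => glauberDist_nonneg β n _⟩
  have hcob : ∀ γ : ℝ, atTop.IsCoboundedUnder (· ≥ ·) fun n : ℕ =>
      glauberDist β n ⌊(n : ℝ) * Real.log n / (2 * (1 - β)) - γ * n⌋₊ := fun γ =>
    IsBoundedUnder.isCoboundedUnder_ge ⟨1, hub γ⟩
  refine tendsto_order.2 ⟨fun a ha => ?_, fun a ha => Eventually.of_forall fun γ => ?_⟩
  · have hδ0 : 0 < min ((1 - a) / 2) 1 := lt_min (by linarith) one_pos
    filter_upwards [eventually_le_glauberDist hβ0 hβ1 hδ0 (min_le_right _ _)] with γ hγ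
    have := le_liminf_of_le (hcob γ) hγ
    have := min_le_left ((1 - a) / 2) 1
    linarith
  · refine lt_of_le_of_lt (liminf_le_of_le (hbelow γ) fun b hb => ?_) ha
    obtain ⟨n, h1, h2⟩ := (hb.and (hub γ)).exists
    exact h1.trans h2

end

end CW
end

section
/- No sign change for a long time has small probability: let β ≤ 1 and suppose n is even. There exists a universal constant c > 0 such that for all states s ∈ Ω_S and all times u, t ≥ 0, the magnetization chain satisfies P(|S_u| > 0, |S_{u+1}| > 0, …, |S_{u+t}| > 0 | S_u = s) ≤ c·n·|s| / √t. -/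
open Filter Real

namespace CW

noncomputable section

/-- `p₋(s) = (1 - tanh(βs))/2`. -/
def pMinus (β s : ℝ) : ℝ := (1 - Real.tanh (β * s)) / 2

/-- The value of the magnetization corresponding to `k` plus spins among `n`
sites: the state space `Ω_S = {-1, -1 + 2/n, …, 1 - 2/n, 1}` is indexed by
`k ∈ {0, 1, …, n}`, with `magVal n k = (2k - n)/n`. -/
def magVal (n : ℕ) (k : Fin (n + 1)) : ℝ := (2 * (k : ℕ) - n) / n

/-- Transition kernel of the magnetization chain of the Curie-Weiss Glauber
dynamics: from `s` move to `s - 2/n` with probability `((1+s)/2) p₋(s - 1/n)`,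
to `s + 2/n` with probability `((1-s)/2) p₊(s + 1/n)`, and stay put
otherwise. -/
def magKernel (β : ℝ) (n : ℕ) (k l : Fin (n + 1)) : ℝ :=
  if (l : ℕ) + 1 = (k : ℕ) then
    ((1 + magVal n k) / 2) * pMinus β (magVal n k - 1 / n)
  else if (k : ℕ) + 1 = (l : ℕ) then
    ((1 - magVal n k) / 2) * pPlus β (magVal n k + 1 / n)
  else if l = k then
    1 - ((1 + magVal n k) / 2) * pMinus β (magVal n k - 1 / n)
      - ((1 - magVal n k) / 2) * pPlus β (magVal n k + 1 / n)
  else 0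

/-- `magSurvive β n t k` is the probability that the magnetization chain
started from the state `k` stays nonzero at all times `0, 1, …, t`, i.e.
`P(|S_u| > 0, |S_{u+1}| > 0, …, |S_{u+t}| > 0 | S_u = magVal n k)` (the chain
is time-homogeneous, so this does not depend on `u`). -/
def magSurvive (β : ℝ) (n : ℕ) : ℕ → Fin (n + 1) → ℝ
  | 0, k => if 2 * (k : ℕ) ≠ n then 1 else 0
  | t + 1, k =>
      if 2 * (k : ℕ) ≠ n then ∑ l, magKernel β n k l * magSurvive β n t l
      else 0

theorem monotone_tanh : Monotone Real.tanh := by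
  intro x y hxy
  have hx := Real.cosh_pos x
  have hy := Real.cosh_pos y
  rw [Real.tanh_eq_sinh_div_cosh, Real.tanh_eq_sinh_div_cosh, div_le_div_iff₀ hx hy]
  have h := Real.sinh_nonneg_iff.2 (sub_nonneg.2 hxy)
  rw [Real.sinh_sub] at h
  linarith

theorem tanh_le_of_le_one {x : ℝ} (hx : x ≤ 1) : Real.tanh x ≤ 23 / 25 := by
  refine (monotone_tanh hx).trans ?_
  have he := Real.exp_one_lt_d9
  have hpos := Real.exp_pos 1
  have hinv := Real.exp_pos (-1)
  have hmul : Real.exp 1 * Real.exp (-1) = 1 := by rw [← Real.exp_add]; simp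
  rw [Real.tanh_eq, div_le_iff₀ (by positivity)]
  nlinarith

theorem pMinus_mem (β s : ℝ) : pMinus β s ∈ Set.Icc (0 : ℝ) 1 := by
  have h₁ := Real.tanh_lt_one (β * s)
  have h₂ := Real.neg_one_lt_tanh (β * s)
  unfold pMinus
  constructor <;> linarith

theorem pPlus_mem (β s : ℝ) : pPlus β s ∈ Set.Icc (0 : ℝ) 1 := by
  have h₁ := Real.tanh_lt_one (β * s)
  have h₂ := Real.neg_one_lt_tanh (β * s)
  unfold pPlus
  constructor <;> linarith

theorem pMinus_neg (β s : ℝ) : pMinus β (-s) = pPlus β s := by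
  simp [pMinus, pPlus, Real.tanh_neg]

theorem pPlus_neg (β s : ℝ) : pPlus β (-s) = pMinus β s := by
  simp [pMinus, pPlus, Real.tanh_neg, sub_eq_add_neg]

/-- Probability of a downward move from `s`, for step parameter `δ = 1 / n`. -/
def downRate (β δ s : ℝ) : ℝ := ((1 + s) / 2) * pMinus β (s - δ)

/-- Probability of an upward move from `s`, for step parameter `δ = 1 / n`. -/
def upRate (β δ s : ℝ) : ℝ := ((1 - s) / 2) * pPlus β (s + δ)

theorem downRate_neg (β δ s : ℝ) : downRate β δ (-s) = upRate β δ s := by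
  unfold downRate upRate
  rw [show -s - δ = -(s + δ) by ring, pMinus_neg, ← sub_eq_add_neg]

theorem upRate_neg (β δ s : ℝ) : upRate β δ (-s) = downRate β δ s := by
  rw [← downRate_neg, neg_neg]

section Rates

variable {β δ s : ℝ}

theorem downRate_nonneg (hs : -1 ≤ s) : 0 ≤ downRate β δ s :=
  mul_nonneg (by linarith) (pMinus_mem _ _).1

theorem upRate_nonneg (hs : s ≤ 1) : 0 ≤ upRate β δ s :=
  mul_nonneg (by linarith) (pPlus_mem _ _).1

theorem downRate_add_upRate_le_one (hs : -1 ≤ s) (hs' : s ≤ 1) :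
    downRate β δ s + upRate β δ s ≤ 1 := by
  have h₁ : downRate β δ s ≤ (1 + s) / 2 :=
    mul_le_of_le_one_right (by linarith) (pMinus_mem _ _).2
  have h₂ : upRate β δ s ≤ (1 - s) / 2 :=
    mul_le_of_le_one_right (by linarith) (pPlus_mem _ _).2
  linarith

theorem upRate_le_downRate (hβ : 0 ≤ β) (hβ' : β ≤ 1) (hδ : 0 ≤ δ) (hs : δ ≤ s) :
    upRate β δ s ≤ downRate β δ s := by
  have ha : Real.tanh (β * (s + δ)) ≤ s + δ :=
    (tanh_le_self (mul_nonneg hβ (by linarith))).trans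
      (mul_le_of_le_one_left (by linarith) hβ')
  have hb : Real.tanh (β * (s - δ)) ≤ s - δ :=
    (tanh_le_self (mul_nonneg hβ (by linarith))).trans
      (mul_le_of_le_one_left (by linarith) hβ')
  have hab : Real.tanh (β * (s - δ)) ≤ Real.tanh (β * (s + δ)) :=
    monotone_tanh (mul_le_mul_of_nonneg_left (by linarith) hβ)
  unfold upRate downRate pPlus pMinus
  nlinarith [mul_nonneg (hδ.trans hs) (sub_nonneg.2 hab)]

theorem le_downRate (hβ' : β ≤ 1) (hδ : 0 ≤ δ) (hs : δ ≤ s) (hs' : s ≤ 1) :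
    1 / 50 ≤ downRate β δ s := by
  have h : Real.tanh (β * (s - δ)) ≤ 23 / 25 :=
    tanh_le_of_le_one (mul_le_one₀ hβ' (by linarith) (by linarith))
  have h₁ : (1 / 25 : ℝ) ≤ pMinus β (s - δ) := by unfold pMinus; linarith
  unfold downRate
  nlinarith

end Rates

/-- A quadratic function of `x / r` which, with `r ^ 2` playing the role of time, dominates the
survival probability of a lazy walk at distance `x` from the absorbing state. -/
def barrier (r x : ℝ) : ℝ := 20 * (x / r) - 50 * (x / r) ^ 2

theorem one_le_barrier {r x : ℝ} (hr : 0 < r) (hx : r / 12 ≤ x) (hx' : x ≤ r / 5) :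
    1 ≤ barrier r x := by
  have h₁ : 1 / 12 ≤ x / r := by rw [le_div_iff₀ hr]; linarith
  have h₂ : x / r ≤ 1 / 5 := by rw [div_le_iff₀ hr]; linarith
  unfold barrier
  nlinarith [mul_nonneg (sub_nonneg.2 h₁) (sub_nonneg.2 h₂)]

theorem barrier_sub_le {r q x : ℝ} (hr : 0 < r) (hrq : r ≤ q) (hq : q ^ 2 = r ^ 2 + 1)
    (hx : 0 ≤ x) (hx' : x ≤ q / 12) : barrier r x - 2 / r ^ 2 ≤ barrier q x := by
  have hq0 : 0 < q := hr.trans_le hrq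
  have hsq : (x / q) ^ 2 ≤ (x / r) ^ 2 := by gcongr
  have hlin : x / r - x / q ≤ 1 / 24 * (1 / r ^ 2) := by
    have hd : x / r - x / q = x / q * ((q - r) / r) := by field_simp
    have h₁ : x / q ≤ 1 / 12 := by rw [div_le_iff₀ hq0]; linarith
    have h₂ : (q - r) / r ≤ 1 / 2 * (1 / r ^ 2) := by
      rw [div_le_iff₀ hr]
      have : 1 / 2 * (1 / r ^ 2) * r = 1 / (2 * r) := by field_simp
      rw [this, le_div_iff₀ (by positivity)]
      nlinarith [sq_nonneg (q - r)]
    rw [hd]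
    calc x / q * ((q - r) / r) ≤ 1 / 12 * (1 / 2 * (1 / r ^ 2)) :=
          mul_le_mul h₁ h₂ (div_nonneg (by linarith) hr.le) (by norm_num)
      _ = 1 / 24 * (1 / r ^ 2) := by ring
  have hr2 : 0 < 1 / r ^ 2 := by positivity
  have h2 : 2 / r ^ 2 = 2 * (1 / r ^ 2) := by ring
  unfold barrier
  linarith

theorem barrier_average_le {r q x u d : ℝ} (hr : 0 < r) (hrq : r ≤ q) (hq : q ^ 2 = r ^ 2 + 1)
    (hx : 0 ≤ x) (hx' : x ≤ q / 12) (hxr : x + 1 ≤ r / 5) (hud : u ≤ d) (hd : 1 / 50 ≤ d) :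
    d * barrier r (x - 1) + u * barrier r (x + 1) + (1 - d - u) * barrier r x ≤ barrier q x := by
  refine le_trans ?_ (barrier_sub_le hr hrq hq hx hx')
  have hinc : 0 ≤ barrier r (x + 1) - barrier r x := by
    have : barrier r (x + 1) - barrier r x = (20 * r - 50 * (2 * x + 1)) / r ^ 2 := by
      unfold barrier; field_simp; ring
    rw [this]
    apply div_nonneg _ (by positivity)
    linarith
  have hconc : barrier r (x + 1) - 2 * barrier r x + barrier r (x - 1) = -(100 * (1 / r ^ 2)) := by
    unfold barrier; field_simp; ring
  have hr2 : 0 < 1 / r ^ 2 := by positivity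
  have h2 : 2 / r ^ 2 = 2 * (1 / r ^ 2) := by ring
  nlinarith [mul_nonneg (sub_nonneg.2 hud) hinc, mul_nonneg (sub_nonneg.2 hd) hr2.le]

theorem magVal_mem {n : ℕ} (hn : 0 < n) (k : Fin (n + 1)) :
    -1 ≤ magVal n k ∧ magVal n k ≤ 1 := by
  have hn' : (0 : ℝ) < n := by exact_mod_cast hn
  have hk : ((k : ℕ) : ℝ) ≤ n := by exact_mod_cast Nat.lt_succ_iff.1 k.2
  have hk0 : (0 : ℝ) ≤ ((k : ℕ) : ℝ) := Nat.cast_nonneg _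
  unfold magVal
  rw [le_div_iff₀ hn', div_le_iff₀ hn']
  constructor <;> linarith

theorem magKernel_nonneg (β : ℝ) {n : ℕ} (hn : 0 < n) (k l : Fin (n + 1)) :
    0 ≤ magKernel β n k l := by
  obtain ⟨h₁, h₂⟩ := magVal_mem hn k
  have hd := downRate_nonneg (β := β) (δ := 1 / n) h₁
  have hu := upRate_nonneg (β := β) (δ := 1 / n) h₂
  have hs := downRate_add_upRate_le_one (β := β) (δ := 1 / n) h₁ h₂
  unfold downRate at hd hs
  unfold upRate at hu hs
  unfold magKernel
  split_ifs
  · exact hd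
  · exact hu
  · linarith
  · exact le_rfl

theorem sum_magKernel_mul (β : ℝ) {n : ℕ} (hn : 0 < n) (k : Fin (n + 1)) (g : ℝ → ℝ) :
    ∑ l : Fin (n + 1), magKernel β n k l * g (l : ℕ) =
      downRate β (1 / n) (magVal n k) * g ((k : ℕ) - 1) +
        upRate β (1 / n) (magVal n k) * g ((k : ℕ) + 1) +
        (1 - downRate β (1 / n) (magVal n k) - upRate β (1 / n) (magVal n k)) * g (k : ℕ) := by
  have hn' : (n : ℝ) ≠ 0 := by exact_mod_cast hn.ne'
  set d := downRate β (1 / n) (magVal n k) with hd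
  set u := upRate β (1 / n) (magVal n k) with hu
  have hsplit : ∀ l : Fin (n + 1), magKernel β n k l * g (l : ℕ) =
      (if (l : ℕ) + 1 = k then d * g ((k : ℕ) - 1) else 0) +
      (if (k : ℕ) + 1 = l then u * g ((k : ℕ) + 1) else 0) +
      (if l = k then (1 - d - u) * g (k : ℕ) else 0) := by
    intro l
    have hkl : l = k ↔ (l : ℕ) = k := Fin.ext_iff
    unfold magKernel
    by_cases h₁ : (l : ℕ) + 1 = k
    · have h₂ : ¬ (k : ℕ) + 1 = l := by omega
      have h₃ : ¬ l = k := by omega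
      have h₄ : ((k : ℕ) : ℝ) - 1 = (l : ℕ) := by rw [← h₁]; push_cast; ring
      simp [h₁, h₂, h₃, h₄, hd, downRate]
    · by_cases h₂ : (k : ℕ) + 1 = l
      · have h₃ : ¬ l = k := by omega
        have h₄ : ((k : ℕ) : ℝ) + 1 = (l : ℕ) := by rw [← h₂]; push_cast; ring
        simp [h₁, h₂, h₃, h₄, hu, upRate]
      · by_cases h₃ : l = k
        · subst h₃
          simp [hd, hu, downRate, upRate]
        · simp [h₁, h₂, h₃]
  have hdown : ∑ l : Fin (n + 1), (if (l : ℕ) + 1 = k then d * g ((k : ℕ) - 1) else 0) =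
      d * g ((k : ℕ) - 1) := by
    by_cases h : (k : ℕ) = 0
    · have : d = 0 := by
        have : magVal n k = -1 := by unfold magVal; rw [h]; field_simp; simp
        rw [hd, downRate, this]; simp
      simp [this]
    · rw [Finset.sum_eq_single (⟨(k : ℕ) - 1, by omega⟩ : Fin (n + 1))]
      · rw [if_pos]; simp only; omega
      · intro l _ hl
        rw [if_neg]
        rintro hlk
        exact hl (Fin.ext (by simp only; omega))
      · simp
  have hup : ∑ l : Fin (n + 1), (if (k : ℕ) + 1 = l then u * g ((k : ℕ) + 1) else 0) =
      u * g ((k : ℕ) + 1) := by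
    by_cases h : (k : ℕ) = n
    · have : u = 0 := by
        have : magVal n k = 1 := by unfold magVal; rw [h]; field_simp; ring
        rw [hu, upRate, this]; simp
      simp [this]
    · rw [Finset.sum_eq_single (⟨(k : ℕ) + 1, by omega⟩ : Fin (n + 1))]
      · simp
      · intro l _ hl
        rw [if_neg]
        rintro hlk
        exact hl (Fin.ext (by simp only; omega))
      · simp
  simp_rw [hsplit, Finset.sum_add_distrib]
  rw [hdown, hup]
  simp

theorem magSurvive_le_one (β : ℝ) {n : ℕ} (hn : 0 < n) (t : ℕ) (k : Fin (n + 1)) :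
    magSurvive β n t k ≤ 1 := by
  induction t generalizing k with
  | zero => unfold magSurvive; split_ifs <;> norm_num
  | succ t ih =>
    unfold magSurvive
    split_ifs
    · have hsum := sum_magKernel_mul β hn k (fun _ => 1)
      calc ∑ l, magKernel β n k l * magSurvive β n t l ≤ ∑ l, magKernel β n k l * 1 :=
            Finset.sum_le_sum fun l _ =>
              mul_le_mul_of_nonneg_left (ih l) (magKernel_nonneg β hn k l)
        _ = 1 := by rw [hsum]; ring
    · norm_num

theorem abs_sub_le_one_of_magKernel_ne_zero {β : ℝ} {n : ℕ} {k l : Fin (n + 1)}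
    (h : magKernel β n k l ≠ 0) : |((l : ℕ) : ℝ) - (k : ℕ)| ≤ 1 := by
  unfold magKernel at h
  split_ifs at h with h₁ h₂ h₃
  · rw [← h₁]; push_cast; simp
  · rw [← h₂]; push_cast; simp
  · simp [h₃]
  · exact absurd rfl h

/-- The barrier, evaluated at the distance to the centre, is a supersolution for the kernel. -/
theorem sum_magKernel_mul_barrier_le {β : ℝ} (hβ : 0 ≤ β) (hβ' : β ≤ 1) {m : ℕ} (hm : 0 < m)
    (k : Fin (2 * m + 1)) (hk : (k : ℕ) ≠ m) {r q : ℝ} (hr : 0 < r) (hrq : r ≤ q)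
    (hq : q ^ 2 = r ^ 2 + 1) (hx : |((k : ℕ) : ℝ) - m| ≤ q / 12)
    (hxr : |((k : ℕ) : ℝ) - m| + 1 ≤ r / 5) :
    ∑ l : Fin (2 * m + 1), magKernel β (2 * m) k l * barrier r |((l : ℕ) : ℝ) - m| ≤
      barrier q |((k : ℕ) : ℝ) - m| := by
  have hm' : (0 : ℝ) < m := by exact_mod_cast hm
  have hδ : (0 : ℝ) ≤ 1 / (2 * m : ℕ) := by positivity
  obtain ⟨hs₁, hs₂⟩ := magVal_mem (n := 2 * m) (by omega) k
  have hval : magVal (2 * m) k = (((k : ℕ) : ℝ) - m) / m := by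
    unfold magVal; push_cast; field_simp
  rw [sum_magKernel_mul β (by omega) k (fun y => barrier r |y - m|)]
  rcases lt_or_gt_of_ne hk with h | h
  · have h1 : ((k : ℕ) : ℝ) + 1 ≤ m := by exact_mod_cast h
    have hs : (1 : ℝ) / (2 * m : ℕ) ≤ -magVal (2 * m) k := by
      rw [hval, ← neg_div, div_le_div_iff₀ (by positivity) hm']
      push_cast
      nlinarith
    have hdu := upRate_le_downRate hβ hβ' hδ hs
    have hd := le_downRate hβ' hδ hs (by linarith)
    rw [upRate_neg, downRate_neg] at hdu
    rw [downRate_neg] at hd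
    have e₀ : |((k : ℕ) : ℝ) - m| = m - (k : ℕ) := by
      rw [abs_of_nonpos (by linarith)]; ring
    have e₁ : |((k : ℕ) : ℝ) - 1 - m| = m - (k : ℕ) + 1 := by
      rw [abs_of_nonpos (by linarith)]; ring
    have e₂ : |((k : ℕ) : ℝ) + 1 - m| = m - (k : ℕ) - 1 := by
      rw [abs_of_nonpos (by linarith)]; ring
    rw [e₀] at hx hxr
    simp only [e₀, e₁, e₂]
    have := barrier_average_le hr hrq hq (by linarith) hx hxr hdu hd
    linarith
  · have h1 : (m : ℝ) + 1 ≤ (k : ℕ) := by exact_mod_cast h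
    have hs : (1 : ℝ) / (2 * m : ℕ) ≤ magVal (2 * m) k := by
      rw [hval, div_le_div_iff₀ (by positivity) hm']
      push_cast
      nlinarith
    have hdu := upRate_le_downRate hβ hβ' hδ hs
    have hd := le_downRate hβ' hδ hs hs₂
    have e₀ : |((k : ℕ) : ℝ) - m| = (k : ℕ) - m := abs_of_nonneg (by linarith)
    have e₁ : |((k : ℕ) : ℝ) - 1 - m| = (k : ℕ) - m - 1 := by
      rw [abs_of_nonneg (by linarith)]; ring
    have e₂ : |((k : ℕ) : ℝ) + 1 - m| = (k : ℕ) - m + 1 := by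
      rw [abs_of_nonneg (by linarith)]; ring
    rw [e₀] at hx hxr
    simp only [e₀, e₁, e₂]
    exact barrier_average_le hr hrq hq (by linarith) hx hxr hdu hd

theorem magSurvive_center (β : ℝ) (m t : ℕ) (k : Fin (2 * m + 1)) (hk : (k : ℕ) = m) :
    magSurvive β (2 * m) t k = 0 := by
  cases t <;> simp [magSurvive, hk]

theorem magSurvive_le_barrier {β : ℝ} (hβ : 0 ≤ β) (hβ' : β ≤ 1) {m : ℕ} (hm : 0 < m) (t : ℕ)
    (k : Fin (2 * m + 1)) (hx : |((k : ℕ) : ℝ) - m| ≤ √(t + 144) / 5) :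
    magSurvive β (2 * m) t k ≤ barrier (√(t + 144)) |((k : ℕ) : ℝ) - m| := by
  have hpos : ∀ t : ℕ, 0 < √((t : ℝ) + 144) := fun t => by positivity
  by_cases hk : (k : ℕ) = m
  · rw [magSurvive_center β m t k hk, hk]
    simp [barrier]
  by_cases hfar : √((t : ℝ) + 144) / 12 ≤ |((k : ℕ) : ℝ) - m|
  · exact (magSurvive_le_one β (by omega) t k).trans (one_le_barrier (hpos t) hfar hx)
  push Not at hfar
  induction t generalizing k with
  | zero =>
    exfalso
    have h12 : √(((0 : ℕ) : ℝ) + 144) = 12 := by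
      rw [show ((0 : ℕ) : ℝ) + 144 = 12 ^ 2 by norm_num]
      exact Real.sqrt_sq (by norm_num)
    rw [h12] at hfar
    have h1 : (1 : ℝ) ≤ |((k : ℕ) : ℝ) - m| := by
      have : (1 : ℤ) ≤ |((k : ℕ) : ℤ) - m| := Int.one_le_abs (by omega)
      exact_mod_cast this
    linarith
  | succ t ih =>
    set r := √((t : ℝ) + 144) with hr
    set q := √(((t + 1 : ℕ) : ℝ) + 144) with hq
    have hr2 : r ^ 2 = t + 144 := Real.sq_sqrt (by positivity)
    have hq2 : q ^ 2 = r ^ 2 + 1 := by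
      rw [hr2, hq, Real.sq_sqrt (by positivity)]; push_cast; ring
    have hr0 : 0 < r := hpos t
    have hq0 : 0 < q := hpos (t + 1)
    have hrq : r ≤ q := by nlinarith
    have hr12 : 12 ≤ r := by
      have : (0 : ℝ) ≤ t := Nat.cast_nonneg t
      nlinarith
    have hqr : q ≤ r + 1 := by nlinarith
    have hxr : |((k : ℕ) : ℝ) - m| + 1 ≤ r / 5 := by linarith
    have hk2 : 2 * (k : ℕ) ≠ 2 * m := by omega
    rw [magSurvive, if_pos hk2]
    refine le_trans (Finset.sum_le_sum fun l _ => ?_)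
      (sum_magKernel_mul_barrier_le hβ hβ' hm k hk hr0 hrq hq2 hfar.le hxr)
    by_cases hK : magKernel β (2 * m) k l = 0
    · simp [hK]
    apply mul_le_mul_of_nonneg_left _ (magKernel_nonneg β (by omega) k l)
    have hl : |((l : ℕ) : ℝ) - m| ≤ r / 5 := by
      have := abs_sub_le ((l : ℕ) : ℝ) (k : ℕ) m
      have := abs_sub_le_one_of_magKernel_ne_zero hK
      linarith
    by_cases hlm : (l : ℕ) = m
    · rw [magSurvive_center β m t l hlm, hlm]
      simp [barrier]
    by_cases hlfar : r / 12 ≤ |((l : ℕ) : ℝ) - m|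
    · exact (magSurvive_le_one β (by omega) t l).trans (one_le_barrier hr0 hlfar hl)
    · exact ih l hl hlm (not_le.1 hlfar)

theorem magSurvive_mul_sqrt_le {β : ℝ} (hβ : 0 ≤ β) (hβ' : β ≤ 1) {m : ℕ} (hm : 0 < m) (t : ℕ)
    (k : Fin (2 * m + 1)) :
    magSurvive β (2 * m) t k * √t ≤ 20 * |((k : ℕ) : ℝ) - m| := by
  have hr0 : 0 < √((t : ℝ) + 144) := by positivity
  have hle : √(t : ℝ) ≤ √((t : ℝ) + 144) := Real.sqrt_le_sqrt (by linarith)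
  have ht := Real.sqrt_nonneg (t : ℝ)
  have hx0 := abs_nonneg (((k : ℕ) : ℝ) - m)
  set r := √((t : ℝ) + 144)
  set x := |((k : ℕ) : ℝ) - m|
  have hP : magSurvive β (2 * m) t k ≤ 20 * (x / r) := by
    by_cases hx : x ≤ r / 5
    · refine (magSurvive_le_barrier hβ hβ' hm t k hx).trans ?_
      unfold barrier
      linarith [sq_nonneg (x / r)]
    · push Not at hx
      have : 1 / 5 ≤ x / r := by rw [le_div_iff₀ hr0]; linarith
      linarith [magSurvive_le_one β (n := 2 * m) (by omega) t k]
  calc magSurvive β (2 * m) t k * √t ≤ 20 * (x / r) * √t := by gcongr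
    _ ≤ 20 * (x / r) * r := by gcongr
    _ = 20 * x := by field_simp

/-- For `0 ≤ β ≤ 1` and `n` even, there is a universal constant `c > 0` such
that for all states `s` and all times `t`, the probability that the
magnetization stays nonzero during `t` steps is at most `c n |s| / √t`
(stated in the multiplied form `P · √t ≤ c n |s|`). -/
theorem mag_no_sign_change :
    ∃ c > (0 : ℝ), ∀ β : ℝ, 0 ≤ β → β ≤ 1 → ∀ n : ℕ, Even n →
      ∀ (t : ℕ) (k : Fin (n + 1)),
        magSurvive β n t k * Real.sqrt t ≤ c * n * |magVal n k| := by
  refine ⟨10, by norm_num, fun β hβ hβ' n hn t k => ?_⟩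
  obtain ⟨m, rfl⟩ : ∃ m, n = 2 * m := hn.two_dvd
  rcases Nat.eq_zero_or_pos m with rfl | hm
  · have hk : (k : ℕ) = 0 := by have := k.2; omega
    rw [magSurvive_center β 0 t k hk]
    simp
  · refine (magSurvive_mul_sqrt_le hβ hβ' hm t k).trans_eq ?_
    have hm' : (0 : ℝ) < m := by exact_mod_cast hm
    have hval : magVal (2 * m) k = (((k : ℕ) : ℝ) - m) / m := by
      unfold magVal; push_cast; field_simp
    rw [hval, abs_div, abs_of_pos hm']
    push_cast
    field_simp
    ring

end

end CW
end
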